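/- arXiv:math/0611358 — 2 statements merged into one kernel-verified Lean document; each statement's English description precedes it below -/
import Mathlib

section
/- If the supremum of the left and right Gorenstein global dimensions of R is finite, then every Gorenstein projective left R-module is Gorenstein flat. -/
/-! Definitions for Gorenstein homological algebra over an arbitrary
associative ring `R` (left modules; right modules are `Rᵐᵒᵖ`-modules). -/

universe u

section Defs

variable (R : Type u) [Ring R]

/-- `0 → A → B → C → 0` is a short exact sequence. -/
def IsSES {A B C : Type u} [AddCommGroup A] [Module R A] [AddCommGroup B] [Module R B]
    [AddCommGroup C] [Module R C] (f : A →ₗ[R] B) (g : B →ₗ[R] C) : Prop :=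
  Function.Injective f ∧ Function.Exact f g ∧ Function.Surjective g

/-- `M` is Gorenstein projective: it is the kernel of a map in a doubly infinite exact
complex of projective modules which stays exact under `Hom_R(-, Q)` for every projective `Q`. -/
def GorensteinProjective (M : Type u) [AddCommGroup M] [Module R M] : Prop :=
  ∃ (P : ℤ → Type u) (_ : ∀ i, AddCommGroup (P i)) (_ : ∀ i, Module R (P i))
    (d : ∀ i, P i →ₗ[R] P (i + 1)),
      (∀ i, Module.Projective R (P i)) ∧
      (∀ i, Function.Exact (d i) (d (i + 1))) ∧
      Nonempty (M ≃ₗ[R] LinearMap.ker (d 0)) ∧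
      (∀ (Q : Type u) (_ : AddCommGroup Q) (_ : Module R Q), Module.Projective R Q →
        ∀ i, Function.Exact (fun g : P (i + 1 + 1) →ₗ[R] Q => g.comp (d (i + 1)))
          (fun g : P (i + 1) →ₗ[R] Q => g.comp (d i)))

/-- `M` is strongly Gorenstein projective: there is a complete projective resolution
with a single projective module `P` and a single map `f`. -/
def StronglyGorensteinProjective (M : Type u) [AddCommGroup M] [Module R M] : Prop :=
  ∃ (P : Type u) (_ : AddCommGroup P) (_ : Module R P) (f : P →ₗ[R] P),
    Module.Projective R P ∧
    Function.Exact f f ∧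
    Nonempty (M ≃ₗ[R] LinearMap.ker f) ∧
    (∀ (Q : Type u) (_ : AddCommGroup Q) (_ : Module R Q), Module.Projective R Q →
      Function.Exact (fun g : P →ₗ[R] Q => g.comp f) (fun g : P →ₗ[R] Q => g.comp f))

/-- `M` is Gorenstein injective (dual to Gorenstein projective). -/
def GorensteinInjective (M : Type u) [AddCommGroup M] [Module R M] : Prop :=
  ∃ (I : ℤ → Type u) (_ : ∀ i, AddCommGroup (I i)) (_ : ∀ i, Module R (I i))
    (d : ∀ i, I i →ₗ[R] I (i + 1)),
      (∀ i, Module.Injective R (I i)) ∧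
      (∀ i, Function.Exact (d i) (d (i + 1))) ∧
      Nonempty (M ≃ₗ[R] LinearMap.ker (d 0)) ∧
      (∀ (E : Type u) (_ : AddCommGroup E) (_ : Module R E), Module.Injective R E →
        ∀ i, Function.Exact (fun g : E →ₗ[R] I i => (d i).comp g)
          (fun g : E →ₗ[R] I (i + 1) => (d (i + 1)).comp g))

/-- `M` is strongly Gorenstein injective. -/
def StronglyGorensteinInjective (M : Type u) [AddCommGroup M] [Module R M] : Prop :=
  ∃ (I : Type u) (_ : AddCommGroup I) (_ : Module R I) (f : I →ₗ[R] I),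
    Module.Injective R I ∧
    Function.Exact f f ∧
    Nonempty (M ≃ₗ[R] LinearMap.ker f) ∧
    (∀ (E : Type u) (_ : AddCommGroup E) (_ : Module R E), Module.Injective R E →
      Function.Exact (fun g : E →ₗ[R] I => f.comp g) (fun g : E →ₗ[R] I => f.comp g))

/-- `M` admits a resolution `0 → G_n → ⋯ → G_0 → M → 0` by modules satisfying `𝒢`
(formalized as an `ℕ`-indexed resolution vanishing in degrees `> n`). -/
def HasLeftResolutionLE
    (𝒢 : ∀ (N : Type u) [AddCommGroup N] [Module R N], Prop)
    (M : Type u) [AddCommGroup M] [Module R M] (n : ℕ) : Prop :=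
  ∃ (G : ℕ → Type u) (_ : ∀ i, AddCommGroup (G i)) (_ : ∀ i, Module R (G i))
    (d : ∀ i, G (i + 1) →ₗ[R] G i) (π : G 0 →ₗ[R] M),
      (∀ i, 𝒢 (G i)) ∧
      (∀ i, n < i → Subsingleton (G i)) ∧
      Function.Surjective π ∧ Function.Exact (d 0) π ∧
      (∀ i, Function.Exact (d (i + 1)) (d i))

/-- `M` admits a coresolution `0 → M → G^0 → ⋯ → G^n → 0` by modules satisfying `𝒢`. -/
def HasRightResolutionLE
    (𝒢 : ∀ (N : Type u) [AddCommGroup N] [Module R N], Prop)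
    (M : Type u) [AddCommGroup M] [Module R M] (n : ℕ) : Prop :=
  ∃ (G : ℕ → Type u) (_ : ∀ i, AddCommGroup (G i)) (_ : ∀ i, Module R (G i))
    (d : ∀ i, G i →ₗ[R] G (i + 1)) (ι : M →ₗ[R] G 0),
      (∀ i, 𝒢 (G i)) ∧
      (∀ i, n < i → Subsingleton (G i)) ∧
      Function.Injective ι ∧ Function.Exact ι (d 0) ∧
      (∀ i, Function.Exact (d i) (d (i + 1)))

variable (M : Type u) [AddCommGroup M] [Module R M]

/-- Projective dimension, valued in `ℕ∞`. -/
noncomputable def pDim : ℕ∞ :=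
  sInf ((↑) '' {n : ℕ | HasLeftResolutionLE R (fun N _ _ => Module.Projective R N) M n})

/-- Injective dimension, valued in `ℕ∞`. -/
noncomputable def iDim : ℕ∞ :=
  sInf ((↑) '' {n : ℕ | HasRightResolutionLE R (fun N _ _ => Module.Injective R N) M n})

/-- Gorenstein projective dimension, valued in `ℕ∞`. -/
noncomputable def gpDim : ℕ∞ :=
  sInf ((↑) '' {n : ℕ | HasLeftResolutionLE R (fun N _ _ => GorensteinProjective R N) M n})

/-- Gorenstein injective dimension, valued in `ℕ∞`. -/
noncomputable def giDim : ℕ∞ :=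
  sInf ((↑) '' {n : ℕ | HasRightResolutionLE R (fun N _ _ => GorensteinInjective R N) M n})

/-- The left global dimension of `R`. -/
noncomputable def gldim : ℕ∞ :=
  sSup {d : ℕ∞ | ∃ (M : Type u) (_ : AddCommGroup M) (_ : Module R M), d = pDim R M}

/-- The left finitistic projective dimension of `R`. -/
noncomputable def FPD : ℕ∞ :=
  sSup {d : ℕ∞ | ∃ (M : Type u) (_ : AddCommGroup M) (_ : Module R M),
    pDim R M ≠ ⊤ ∧ d = pDim R M}

/-- The left Gorenstein global dimension of `R`: `sup { Gpd_R(M) }`. -/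
noncomputable def GPgldim : ℕ∞ :=
  sSup {d : ℕ∞ | ∃ (M : Type u) (_ : AddCommGroup M) (_ : Module R M), d = gpDim R M}

/-- `sup { Gid_R(M) }` over all left `R`-modules `M`. -/
noncomputable def GIgldim : ℕ∞ :=
  sSup {d : ℕ∞ | ∃ (M : Type u) (_ : AddCommGroup M) (_ : Module R M), d = giDim R M}

end Defs
section Tensor

open TensorProduct

variable (R : Type u) [Ring R]

/-- The defining relations of the tensor product `N ⊗_R M` of a right `R`-module `N`
and a left `R`-module `M`, inside the tensor product of abelian groups `N ⊗[ℤ] M`. -/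
noncomputable def tensorRel (N : Type u) [AddCommGroup N] [Module Rᵐᵒᵖ N]
    (M : Type u) [AddCommGroup M] [Module R M] : AddSubgroup (N ⊗[ℤ] M) :=
  AddSubgroup.closure {x | ∃ (r : R) (n : N) (m : M),
    x = (MulOpposite.op r • n) ⊗ₜ[ℤ] m - n ⊗ₜ[ℤ] (r • m)}

/-- The tensor product `N ⊗_R M` (an abelian group) of a right `R`-module `N` and a
left `R`-module `M` over the (possibly noncommutative) ring `R`. -/
abbrev bTensor (N : Type u) [AddCommGroup N] [Module Rᵐᵒᵖ N]
    (M : Type u) [AddCommGroup M] [Module R M] : Type u :=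
  (N ⊗[ℤ] M) ⧸ tensorRel R N M

/-- The map `N ⊗_R M →+ N ⊗_R M'` induced by a map `f : M →ₗ[R] M'` of left modules. -/
noncomputable def tmapRight (N : Type u) [AddCommGroup N] [Module Rᵐᵒᵖ N]
    {M M' : Type u} [AddCommGroup M] [Module R M] [AddCommGroup M'] [Module R M']
    (f : M →ₗ[R] M') : bTensor R N M →+ bTensor R N M' :=
  QuotientAddGroup.map _ _ (LinearMap.lTensor N (f.restrictScalars ℤ)).toAddMonoidHom <| by
    rw [tensorRel, AddSubgroup.closure_le]
    rintro x ⟨r, n, m, rfl⟩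
    simp only [AddSubgroup.coe_comap, Set.mem_preimage, LinearMap.toAddMonoidHom_coe,
      map_sub, LinearMap.lTensor_tmul, SetLike.mem_coe]
    refine AddSubgroup.subset_closure ⟨r, n, f m, ?_⟩
    simp [LinearMap.map_smul]

/-- The map `N ⊗_R M →+ N' ⊗_R M` induced by a map `g : N →ₗ[Rᵐᵒᵖ] N'` of right modules. -/
noncomputable def tmapLeft {N N' : Type u} [AddCommGroup N] [Module Rᵐᵒᵖ N]
    [AddCommGroup N'] [Module Rᵐᵒᵖ N']
    (M : Type u) [AddCommGroup M] [Module R M]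
    (g : N →ₗ[Rᵐᵒᵖ] N') : bTensor R N M →+ bTensor R N' M :=
  QuotientAddGroup.map _ _ (LinearMap.rTensor M (g.restrictScalars ℤ)).toAddMonoidHom <| by
    rw [tensorRel, AddSubgroup.closure_le]
    rintro x ⟨r, n, m, rfl⟩
    simp only [AddSubgroup.coe_comap, Set.mem_preimage, LinearMap.toAddMonoidHom_coe,
      map_sub, LinearMap.rTensor_tmul, SetLike.mem_coe]
    refine AddSubgroup.subset_closure ⟨r, g n, m, ?_⟩
    simp [LinearMap.map_smul]

/-- A left `R`-module `M` is flat if `- ⊗_R M` preserves injectivity of maps of right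
`R`-modules. -/
def ModFlat (M : Type u) [AddCommGroup M] [Module R M] : Prop :=
  ∀ (N N' : Type u) (_ : AddCommGroup N) (_ : Module Rᵐᵒᵖ N)
    (_ : AddCommGroup N') (_ : Module Rᵐᵒᵖ N') (g : N →ₗ[Rᵐᵒᵖ] N'),
      Function.Injective g → Function.Injective (tmapLeft R M g)

/-- `M` is Gorenstein flat: it is the kernel of a map in a doubly infinite exact complex
of flat modules which stays exact under `E ⊗_R -` for every injective right `R`-module `E`. -/
def GorensteinFlat (M : Type u) [AddCommGroup M] [Module R M] : Prop :=
  ∃ (F : ℤ → Type u) (_ : ∀ i, AddCommGroup (F i)) (_ : ∀ i, Module R (F i))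
    (d : ∀ i, F i →ₗ[R] F (i + 1)),
      (∀ i, ModFlat R (F i)) ∧
      (∀ i, Function.Exact (d i) (d (i + 1))) ∧
      Nonempty (M ≃ₗ[R] LinearMap.ker (d 0)) ∧
      (∀ (E : Type u) (_ : AddCommGroup E) (_ : Module Rᵐᵒᵖ E), Module.Injective Rᵐᵒᵖ E →
        ∀ i, Function.Exact (tmapRight R E (d i)) (tmapRight R E (d (i + 1))))

/-- Flat dimension, valued in `ℕ∞`. -/
noncomputable def fDim (M : Type u) [AddCommGroup M] [Module R M] : ℕ∞ :=
  sInf ((↑) '' {n : ℕ | HasLeftResolutionLE R (fun N _ _ => ModFlat R N) M n})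

/-- Gorenstein flat dimension, valued in `ℕ∞`. -/
noncomputable def gfDim (M : Type u) [AddCommGroup M] [Module R M] : ℕ∞ :=
  sInf ((↑) '' {n : ℕ | HasLeftResolutionLE R (fun N _ _ => GorensteinFlat R N) M n})

/-- The weak global dimension of `R`. -/
noncomputable def wgldim : ℕ∞ :=
  sSup {d : ℕ∞ | ∃ (M : Type u) (_ : AddCommGroup M) (_ : Module R M), d = fDim R M}

/-- The left weak Gorenstein global dimension of `R`: `sup { Gfd_R(M) }`. -/
noncomputable def GFgldim : ℕ∞ :=
  sSup {d : ℕ∞ | ∃ (M : Type u) (_ : AddCommGroup M) (_ : Module R M), d = gfDim R M}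

end Tensor
section Aux

/-- Descend a linear map along a surjection. -/
theorem aux_descend {S : Type*} [Ring S] {X B Q : Type*} [AddCommGroup X] [Module S X]
    [AddCommGroup B] [Module S B] [AddCommGroup Q] [Module S Q]
    (s : X →ₗ[S] B) (hs : Function.Surjective s) (h : X →ₗ[S] Q)
    (hk : ∀ x, s x = 0 → h x = 0) : ∃ g : B →ₗ[S] Q, ∀ x, g (s x) = h x := by
  refine ⟨(Submodule.liftQ (LinearMap.ker s) h (fun x hx => hk x hx)).comp
    (s.quotKerEquivOfSurjective hs).symm.toLinearMap, fun x => ?_⟩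
  have : (s.quotKerEquivOfSurjective hs).symm (s x) = Submodule.Quotient.mk x := by
    rw [LinearEquiv.symm_apply_eq]; rfl
  rw [LinearMap.comp_apply, LinearEquiv.coe_coe, this]
  rfl

variable (S : Type u) [Ring S]

/-- Finite iterated extensions of Gorenstein projective modules. -/
inductive AuxX : ∀ (N : Type u) [AddCommGroup N] [Module S N], Prop
  | of_gp (M : Type u) [AddCommGroup M] [Module S M]
      (P : ℤ → Type u) [∀ i, AddCommGroup (P i)] [∀ i, Module S (P i)]
      (d : ∀ i, P i →ₗ[S] P (i + 1))
      (hP : ∀ i, Module.Projective S (P i))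
      (hd : ∀ i, Function.Exact (d i) (d (i + 1)))
      (j : ℤ) (e : M ≃ₗ[S] LinearMap.ker (d j))
      (hQ : ∀ (Q : Type u) (_ : AddCommGroup Q) (_ : Module S Q), Module.Projective S Q →
        ∀ i, Function.Exact (fun g : P (i + 1 + 1) →ₗ[S] Q => g.comp (d (i + 1)))
          (fun g : P (i + 1) →ₗ[S] Q => g.comp (d i))) : AuxX M
  | ext (A B C : Type u) [AddCommGroup A] [Module S A] [AddCommGroup B] [Module S B]
      [AddCommGroup C] [Module S C] (f : A →ₗ[S] B) (g : B →ₗ[S] C)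
      (h : IsSES S f g) (hA : AuxX A) (hC : AuxX C) : AuxX B

/-- `Ext^1(X, projective) = 0`. -/
def AuxE1 (X : Type u) [AddCommGroup X] [Module S X] : Prop :=
  ∀ (A B Q : Type u) [AddCommGroup A] [Module S A] [AddCommGroup B] [Module S B]
    [AddCommGroup Q] [Module S Q] (i : A →ₗ[S] B) (p : B →ₗ[S] X), IsSES S i p →
    Module.Projective S Q → ∀ f : A →ₗ[S] Q, ∃ g : B →ₗ[S] Q, ∀ a, g (i a) = f a

variable {S}

theorem AuxX.e1 {X : Type u} [AddCommGroup X] [Module S X] (h : AuxX S X) : AuxE1 S X := by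
  induction h with
  | of_gp M P d hP hd j e hQ =>
    intro A B Q _ _ _ _ _ _ i p ⟨hi, hip, hp⟩ hQ' f
    obtain ⟨k, rfl⟩ : ∃ k, j = k + 1 + 1 + 1 := ⟨j - 3, by ring⟩
    have hdd : ∀ i x, d (i + 1) (d i x) = 0 := fun i x => (hd i).apply_apply_eq_zero x
    -- the projection `P (k+2) → M`
    let q : P (k + 1 + 1) →ₗ[S] M := e.symm.toLinearMap.comp
      ((d (k + 1 + 1)).codRestrict _ (fun x => hdd _ x))
    have hq : ∀ x, q x = 0 ↔ d (k + 1 + 1) x = 0 := by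
      intro x
      simp only [q, LinearMap.comp_apply, LinearEquiv.coe_coe, LinearEquiv.map_eq_zero_iff]
      rw [Subtype.ext_iff]; rfl
    have hqs : Function.Surjective q := by
      intro m
      obtain ⟨x, hx⟩ := (hd (k + 1 + 1) (e m)).1 (e m).2
      refine ⟨x, ?_⟩
      simp only [q, LinearMap.comp_apply, LinearEquiv.coe_coe]
      rw [LinearEquiv.symm_apply_eq, Subtype.ext_iff]; exact hx
    haveI := hP
    obtain ⟨φ, hφ⟩ := Module.projective_lifting_property p q hp
    have hφ' : ∀ x, p (φ x) = q x := fun x => LinearMap.congr_fun hφ x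
    -- restrict to `P (k+1) → A`
    let eA : A ≃ₗ[S] LinearMap.range i := LinearEquiv.ofInjective i hi
    let ψ : P (k + 1) →ₗ[S] A := eA.symm.toLinearMap.comp
      ((φ.comp (d (k + 1))).codRestrict (LinearMap.range i) (fun x => by
        rw [LinearMap.mem_range]
        refine (hip _).1 ?_
        rw [LinearMap.comp_apply, hφ', hq, hdd]))
    have hψ : ∀ x, i (ψ x) = φ (d (k + 1) x) := by
      intro x
      have := congrArg Subtype.val (eA.apply_symm_apply
        (((φ.comp (d (k + 1))).codRestrict (LinearMap.range i) (fun x => by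
        rw [LinearMap.mem_range]
        refine (hip _).1 ?_
        rw [LinearMap.comp_apply, hφ', hq, hdd])) x))
      exact this
    have h0 : (f.comp ψ).comp (d k) = 0 := by
      ext x
      have : ψ (d k x) = 0 := hi (by rw [hψ, hdd, map_zero, map_zero])
      simp [this]
    obtain ⟨g, hg⟩ := (hQ Q _ _ hQ' k (f.comp ψ)).1 h0
    have hg' : ∀ x, g (d (k + 1) x) = f (ψ x) := fun x => LinearMap.congr_fun hg x
    obtain ⟨r, hr⟩ := aux_descend (i.coprod φ) (by
      intro b
      obtain ⟨x, hx⟩ := hqs (p b)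
      obtain ⟨a, ha⟩ := (hip (b - φ x)).1 (by rw [map_sub, hφ', hx, sub_self])
      exact ⟨(a, x), by simp [ha]⟩) (f.coprod g) (by
      rintro ⟨a, x⟩ hax
      simp only [LinearMap.coprod_apply] at hax ⊢
      have h1 : q x = 0 := by
        rw [← hφ', eq_neg_of_add_eq_zero_right hax, map_neg, hip.apply_apply_eq_zero, neg_zero]
      obtain ⟨y, rfl⟩ := (hd (k + 1) x).1 ((hq x).1 h1)
      rw [hg', ← map_add]
      rw [← hψ, ← map_add] at hax
      rw [hi (hax.trans (map_zero i).symm), map_zero])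
    exact ⟨r, fun a => by simpa using hr (a, 0)⟩
  | ext A' B' C' f' g' h hA hC ihA ihC =>
    intro A B Q _ _ _ _ _ _ i p ⟨hi, hip, hp⟩ hQ' f
    obtain ⟨hf', hfg', hg'⟩ := h
    let p2 := g'.comp p
    let B1 := LinearMap.ker p2
    let i1 : A →ₗ[S] B1 := i.codRestrict B1 (fun a => by
      simp [B1, p2, hip.apply_apply_eq_zero])
    let eA : A' ≃ₗ[S] LinearMap.range f' := LinearEquiv.ofInjective f' hf'
    have hmem : ∀ b : B1, (p.comp B1.subtype) b ∈ LinearMap.range f' :=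
      fun b => (hfg' _).1 b.2
    let p1 : B1 →ₗ[S] A' := eA.symm.toLinearMap.comp
      ((p.comp B1.subtype).codRestrict (LinearMap.range f') hmem)
    have hp1 : ∀ b : B1, f' (p1 b) = p b := fun b =>
      congrArg Subtype.val (eA.apply_symm_apply
        (((p.comp B1.subtype).codRestrict (LinearMap.range f') hmem) b))
    obtain ⟨g1, hg1⟩ := ihA A B1 Q i1 p1 ⟨fun a b hab => hi (congrArg Subtype.val hab), by
      intro b
      constructor
      · intro hb
        obtain ⟨a, ha⟩ := (hip b.1).1 (by rw [← hp1, hb, map_zero])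
        exact ⟨a, Subtype.ext ha⟩
      · rintro ⟨a, rfl⟩
        apply hf'
        rw [hp1, map_zero]
        exact hip.apply_apply_eq_zero a, by
      intro a
      obtain ⟨b, hb⟩ := hp (f' a)
      refine ⟨⟨b, ?_⟩, hf' ?_⟩
      · simp [B1, p2, hb, hfg'.apply_apply_eq_zero]
      · rw [hp1]; exact hb⟩ hQ' f
    obtain ⟨g2, hg2⟩ := ihC B1 B Q B1.subtype p2 ⟨B1.subtype_injective, by
      intro b
      constructor
      · intro hb; exact ⟨⟨b, hb⟩, rfl⟩
      · rintro ⟨b, rfl⟩; exact b.2, hg'.comp hp⟩ hQ' g1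
    exact ⟨g2, fun a => (hg2 (i1 a)).trans (hg1 a)⟩

/-- Horseshoe-like lemma. -/
theorem aux_horseshoe {K G0 Q G P0 PG C0 CG : Type u}
    [AddCommGroup K] [Module S K] [AddCommGroup G0] [Module S G0]
    [AddCommGroup Q] [Module S Q] [AddCommGroup G] [Module S G]
    [AddCommGroup P0] [Module S P0] [AddCommGroup PG] [Module S PG]
    [AddCommGroup C0] [Module S C0] [AddCommGroup CG] [Module S CG]
    (a : K →ₗ[S] Q) (b : Q →ₗ[S] G) (hab : IsSES S a b)
    (j : K →ₗ[S] G0) (hj : Function.Injective j)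
    (u : G0 →ₗ[S] P0) (u' : P0 →ₗ[S] C0) (hu : IsSES S u u')
    (v : G →ₗ[S] PG) (v' : PG →ₗ[S] CG) (hv : IsSES S v v')
    (hP0 : Module.Projective S P0) (hG : AuxE1 S G) (hC0 : AuxX S C0) (hCG : AuxX S CG) :
    ∃ w : Q →ₗ[S] P0 × PG, Function.Injective w ∧ (∀ k, w (a k) = (u (j k), 0)) ∧
      (∀ x, (w x).2 = v (b x)) ∧
      ∃ (C : Type u) (_ : AddCommGroup C) (_ : Module S C) (q : P0 × PG →ₗ[S] C),
        Function.Surjective q ∧ AuxX S C ∧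
        ∀ p, q p = 0 ↔ ∃ g x, p = (u g, 0) + w x := by
  obtain ⟨φ, hφ⟩ := hG K Q P0 a b hab hP0 (u.comp j)
  obtain ⟨ha, hab, hb⟩ := hab
  obtain ⟨hu, huu, hu'⟩ := hu
  obtain ⟨hv, hvv, hv'⟩ := hv
  let w : Q →ₗ[S] P0 × PG := φ.prod (v.comp b)
  have hwa : ∀ k, w (a k) = (u (j k), 0) := fun k => by
    simp [w, hφ, hab.apply_apply_eq_zero]
  have hw2 : ∀ x, (w x).2 = v (b x) := fun x => rfl
  have hker : ∀ x, (w x).2 = 0 → ∃ k, a k = x := fun x hx =>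
    (hab x).1 (hv (by rw [← hw2, hx, map_zero]))
  refine ⟨w, ?_, hwa, hw2, ?_⟩
  · rw [injective_iff_map_eq_zero]
    intro x hx
    obtain ⟨k, rfl⟩ := hker x (by rw [hx]; rfl)
    rw [hwa] at hx
    have h1 : u (j k) = 0 := congrArg Prod.fst hx
    have h2 : j k = 0 := hu (h1.trans (map_zero u).symm)
    have h3 : k = 0 := hj (h2.trans (map_zero j).symm)
    rw [h3, map_zero]
  · let W : Submodule S (P0 × PG) :=
      LinearMap.range ((LinearMap.inl S P0 PG).comp u) ⊔ LinearMap.range w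
    have hq : ∀ p, W.mkQ p = 0 ↔ ∃ g x, p = (u g, 0) + w x := by
      intro p
      rw [Submodule.mkQ_apply, Submodule.Quotient.mk_eq_zero, Submodule.mem_sup]
      constructor
      · rintro ⟨_, ⟨g, rfl⟩, _, ⟨x, rfl⟩, rfl⟩
        exact ⟨g, x, rfl⟩
      · rintro ⟨g, x, rfl⟩
        exact ⟨_, ⟨g, rfl⟩, _, ⟨x, rfl⟩, rfl⟩
    refine ⟨(P0 × PG) ⧸ W, inferInstance, inferInstance, W.mkQ, W.mkQ_surjective, ?_, hq⟩
    have hqs := W.mkQ_surjective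
    generalize W.mkQ = q at hq hqs
    obtain ⟨s, hs⟩ := aux_descend u' hu' (q.comp (LinearMap.inl S P0 PG)) (by
      intro x hx
      obtain ⟨g, rfl⟩ := (huu x).1 hx
      exact (hq _).2 ⟨g, 0, by simp⟩)
    obtain ⟨t, ht⟩ := aux_descend q hqs (v'.comp (LinearMap.snd S P0 PG)) (by
      intro x hx
      obtain ⟨g, y, rfl⟩ := (hq x).1 hx
      simp [hw2, hvv.apply_apply_eq_zero])
    refine AuxX.ext C0 _ CG s t ⟨?_, ?_, ?_⟩ hC0 hCG
    · rw [injective_iff_map_eq_zero]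
      intro c hc
      obtain ⟨p, rfl⟩ := hu' c
      rw [hs] at hc
      obtain ⟨g, x, hx⟩ := (hq _).1 hc
      have h2 : (w x).2 = 0 := by simpa using (congrArg Prod.snd hx).symm
      obtain ⟨k, rfl⟩ := hker x h2
      rw [hwa] at hx
      have h1 : p = u g + u (j k) := congrArg Prod.fst hx
      rw [h1, ← map_add]
      exact huu.apply_apply_eq_zero _
    · intro c
      constructor
      · intro hc
        obtain ⟨⟨p0, pg⟩, rfl⟩ := hqs c
        rw [ht] at hc
        obtain ⟨g, hg⟩ := (hvv pg).1 hc
        obtain ⟨x, rfl⟩ := hb g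
        have h0 : q (w x) = 0 := (hq _).2 ⟨0, x, by simp⟩
        refine ⟨u' (p0 - (w x).1), ?_⟩
        rw [hs]
        have : (p0, pg) = (p0 - (w x).1, 0) + w x := by
          ext
          · simp
          · simp [hw2, hg]
        rw [this, map_add, h0, add_zero]; rfl
      · rintro ⟨c, rfl⟩
        obtain ⟨p, rfl⟩ := hu' c
        rw [hs, LinearMap.comp_apply, ht]; simp
    · intro c
      obtain ⟨p, rfl⟩ := hv' c
      exact ⟨q (0, p), by rw [ht]; rfl⟩

/-- Every iterated extension of Gorenstein projectives embeds in a projective with cokernel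
of the same kind. -/
theorem AuxX.embed {X : Type u} [AddCommGroup X] [Module S X] (h : AuxX S X) :
    ∃ (P C : Type u) (_ : AddCommGroup P) (_ : Module S P) (_ : AddCommGroup C) (_ : Module S C)
      (u : X →ₗ[S] P) (u' : P →ₗ[S] C), Module.Projective S P ∧ IsSES S u u' ∧ AuxX S C := by
  induction h with
  | of_gp M P d hP hd j e hQ =>
    refine ⟨P j, LinearMap.ker (d (j + 1)), inferInstance, inferInstance, inferInstance,
      inferInstance, (LinearMap.ker (d j)).subtype.comp e.toLinearMap,
      (d j).codRestrict _ (fun x => (hd j).apply_apply_eq_zero x), hP j, ⟨?_, ?_, ?_⟩,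
      AuxX.of_gp _ P d hP hd (j + 1) (LinearEquiv.refl _ _) hQ⟩
    · exact (Submodule.subtype_injective _).comp e.injective
    · intro x
      rw [Subtype.ext_iff]
      constructor
      · intro hx
        exact ⟨e.symm ⟨x, hx⟩, by simp⟩
      · rintro ⟨m, rfl⟩
        exact (e m).2
    · rintro ⟨x, hx⟩
      obtain ⟨y, hy⟩ := (hd j x).1 hx
      exact ⟨y, Subtype.ext hy⟩
  | ext A B C f g h hA hC ihA ihC =>
    obtain ⟨P0, C0, _, _, _, _, u, u', hP0, hu, hC0⟩ := ihA
    obtain ⟨PG, CG, _, _, _, _, v, v', hPG, hv, hCG⟩ := ihC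
    obtain ⟨w, hw, hwa, hw2, C', _, _, q, hqs, hC', hq⟩ := aux_horseshoe f g h
      LinearMap.id Function.injective_id u u' hu v v' hv hP0 hC.e1 hC0 hCG
    refine ⟨P0 × PG, C', inferInstance, inferInstance, inferInstance, inferInstance, w, q,
      inferInstance, ⟨hw, ?_, hqs⟩, hC'⟩
    intro p
    rw [hq]
    constructor
    · rintro ⟨g, x, rfl⟩
      exact ⟨f g + x, by rw [map_add, hwa]; rfl⟩
    · rintro ⟨x, rfl⟩
      exact ⟨0, x, by simp⟩

/-- A module of finite Gorenstein projective dimension embeds in a module of any class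
containing the projectives and closed under cokernels of monomorphisms. -/
theorem aux_main (𝒬 : ∀ (N : Type u) [AddCommGroup N] [Module S N], Prop)
    (hproj : ∀ (N : Type u) [AddCommGroup N] [Module S N], Module.Projective S N → 𝒬 N)
    (hcok : ∀ (A B C : Type u) [AddCommGroup A] [Module S A] [AddCommGroup B] [Module S B]
      [AddCommGroup C] [Module S C] (f : A →ₗ[S] B) (g : B →ₗ[S] C), IsSES S f g →
      𝒬 A → 𝒬 B → 𝒬 C) (n : ℕ) :
    ∀ (E : Type u) [AddCommGroup E] [Module S E],
      HasLeftResolutionLE S (fun N _ _ => GorensteinProjective S N) E n →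
      ∃ (Q G : Type u) (_ : AddCommGroup Q) (_ : Module S Q) (_ : AddCommGroup G)
        (_ : Module S G) (a : E →ₗ[S] Q) (b : Q →ₗ[S] G), IsSES S a b ∧ 𝒬 Q ∧ AuxX S G := by
  have key : ∀ (N : Type u) [AddCommGroup N] [Module S N], GorensteinProjective S N →
      AuxX S N := by
    intro N _ _ ⟨P, _, _, d, hP, hd, ⟨e⟩, hQ⟩
    exact AuxX.of_gp N P d hP hd 0 e hQ
  induction n with
  | zero =>
    intro E _ _ ⟨G, _, _, d, π, hG, h0, hπ, hdπ, hd⟩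
    have hinj : Function.Injective π := by
      rw [injective_iff_map_eq_zero]
      intro x hx
      obtain ⟨y, rfl⟩ := (hdπ x).1 hx
      haveI := h0 1 one_pos
      rw [Subsingleton.elim y 0, map_zero]
    obtain ⟨P, C, _, _, _, _, u, u', hP, ⟨h1, h2, h3⟩, hC⟩ := (key _ (hG 0)).embed
    let e := LinearEquiv.ofBijective π ⟨hinj, hπ⟩
    refine ⟨P, C, inferInstance, inferInstance, inferInstance, inferInstance,
      u.comp e.symm.toLinearMap, u', ⟨h1.comp e.symm.injective, ?_, h3⟩, hproj _ hP, hC⟩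
    intro p
    rw [h2 p]
    constructor
    · rintro ⟨x, rfl⟩
      exact ⟨e x, by simp⟩
    · rintro ⟨x, rfl⟩
      exact ⟨e.symm x, rfl⟩
  | succ n ih =>
    intro E _ _ ⟨G, _, _, d, π, hG, h0, hπ, hdπ, hd⟩
    obtain ⟨Q, G', _, _, _, _, a, b, hab, hQ, hG'⟩ := ih (LinearMap.ker π)
      ⟨fun i => G (i + 1), inferInstance, inferInstance, fun i => d (i + 1),
        (d 0).codRestrict _ (fun x => hdπ.apply_apply_eq_zero x), fun i => hG _,
        fun i hi => h0 _ (by omega), by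
          rintro ⟨x, hx⟩
          obtain ⟨y, hy⟩ := (hdπ x).1 hx
          exact ⟨y, Subtype.ext hy⟩, by
          intro x
          rw [Subtype.ext_iff]
          exact hd 0 x, fun i => hd _⟩
    obtain ⟨P0, C0, _, _, _, _, u, u', hP0, hu, hC0⟩ := (key _ (hG 0)).embed
    obtain ⟨PG, CG, _, _, _, _, v, v', hPG, hv, hCG⟩ := hG'.embed
    obtain ⟨w, hw, hwa, hw2, C', _, _, q, hqs, hC', hq⟩ := aux_horseshoe a b hab
      (LinearMap.ker π).subtype (Submodule.subtype_injective _) u u' hu v v' hv hP0 hG'.e1 hC0 hCG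
    obtain ⟨ha, hab, hb⟩ := hab
    let m := (LinearMap.range w).mkQ
    have hm : ∀ p, m p = 0 ↔ ∃ x, w x = p := fun p => by
      simp only [m, Submodule.mkQ_apply]
      rw [Submodule.Quotient.mk_eq_zero, LinearMap.mem_range]
    have hms : Function.Surjective m := Submodule.mkQ_surjective _
    obtain ⟨s, hs⟩ := aux_descend π hπ (m.comp ((LinearMap.inl S P0 PG).comp u)) (by
      intro x hx
      refine (hm _).2 ⟨a ⟨x, hx⟩, ?_⟩
      rw [hwa]; rfl)
    obtain ⟨t, ht⟩ := aux_descend m hms q (by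
      intro x hx
      obtain ⟨y, rfl⟩ := (hm x).1 hx
      exact (hq _).2 ⟨0, y, by simp⟩)
    refine ⟨(P0 × PG) ⧸ LinearMap.range w, C', inferInstance, inferInstance, inferInstance,
      inferInstance, s, t, ⟨?_, ?_, ?_⟩, hcok _ _ _ w m ⟨hw, hm, hms⟩ hQ
        (hproj _ inferInstance), hC'⟩
    · rw [injective_iff_map_eq_zero]
      intro x hx
      obtain ⟨x, rfl⟩ := hπ x
      rw [hs] at hx
      obtain ⟨y, hy⟩ := (hm _).1 hx
      have h2 : v (b y) = 0 := by rw [← hw2, hy]; rfl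
      obtain ⟨k, rfl⟩ := (hab y).1 (hv.1 (h2.trans (map_zero v).symm))
      rw [hwa] at hy
      have h3 : u (k : G 0) = u x := congrArg Prod.fst hy
      rw [← hu.1 h3]
      exact k.2
    · intro c
      obtain ⟨p, rfl⟩ := hms c
      rw [ht, hq]
      constructor
      · rintro ⟨g, x, rfl⟩
        refine ⟨π g, ?_⟩
        rw [hs, map_add, (hm (w x)).2 ⟨x, rfl⟩, add_zero]; rfl
      · rintro ⟨x, hx⟩
        obtain ⟨x, rfl⟩ := hπ x
        rw [hs] at hx
        obtain ⟨y, hy⟩ := (hm (p - (u x, 0))).1 (by rw [map_sub, ← hx]; exact sub_self _)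
        exact ⟨x, y, by rw [hy]; abel⟩
    · intro c
      obtain ⟨p, rfl⟩ := hqs c
      exact ⟨m p, ht p⟩

end Aux

section AuxTensor

open TensorProduct

variable {R : Type u} [Ring R]

/-- pure tensors -/
noncomputable def bt (R : Type u) [Ring R] (N : Type u) [AddCommGroup N] [Module Rᵐᵒᵖ N]
    (M : Type u) [AddCommGroup M] [Module R M] (n : N) (m : M) : bTensor R N M :=
  QuotientAddGroup.mk (n ⊗ₜ[ℤ] m)

section
variable {N N' : Type u} [AddCommGroup N] [Module Rᵐᵒᵖ N] [AddCommGroup N'] [Module Rᵐᵒᵖ N']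
  {M M' : Type u} [AddCommGroup M] [Module R M] [AddCommGroup M'] [Module R M']

theorem tmapRight_bt (f : M →ₗ[R] M') (n : N) (m : M) :
    tmapRight R N f (bt R N M n m) = bt R N M' n (f m) := rfl

theorem tmapLeft_bt (f : N →ₗ[Rᵐᵒᵖ] N') (n : N) (m : M) :
    tmapLeft R M f (bt R N M n m) = bt R N' M (f n) m := rfl

theorem bt_add_left (n n' : N) (m : M) : bt R N M (n + n') m = bt R N M n m + bt R N M n' m := by
  simp only [bt, TensorProduct.add_tmul]; rfl

theorem bt_add_right (n : N) (m m' : M) : bt R N M n (m + m') = bt R N M n m + bt R N M n m' := by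
  simp only [bt, TensorProduct.tmul_add]; rfl

theorem bt_smul (r : R) (n : N) (m : M) :
    bt R N M (MulOpposite.op r • n) m = bt R N M n (r • m) := by
  simp only [bt]
  rw [← sub_eq_zero, ← QuotientAddGroup.mk_sub, QuotientAddGroup.eq_zero_iff]
  exact AddSubgroup.subset_closure ⟨r, n, m, rfl⟩

theorem bt_induction {p : bTensor R N M → Prop} (h0 : p 0) (h1 : ∀ n m, p (bt R N M n m))
    (h2 : ∀ x y, p x → p y → p (x + y)) (x : bTensor R N M) : p x := by
  induction x using QuotientAddGroup.induction_on with
  | H z =>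
    induction z with
    | zero => exact h0
    | tmul n m => exact h1 n m
    | add x y hx hy => exact h2 _ _ hx hy

theorem bt_ext {X : Type*} [AddCommGroup X] (f g : bTensor R N M →+ X)
    (h : ∀ n m, f (bt R N M n m) = g (bt R N M n m)) (x) : f x = g x := by
  induction x using bt_induction with
  | h0 => simp
  | h1 n m => exact h n m
  | h2 x y hx hy => simp [hx, hy]

/-- bt as biadditive map -/
noncomputable def btHom (R : Type u) [Ring R] (N : Type u) [AddCommGroup N] [Module Rᵐᵒᵖ N]
    (M : Type u) [AddCommGroup M] [Module R M] : N →+ M →+ bTensor R N M :=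
  AddMonoidHom.mk' (fun n => AddMonoidHom.mk' (bt R N M n) (bt_add_right n))
    (fun n n' => by ext m; exact bt_add_left n n' m)

/-- universal property -/
noncomputable def btLift {X : Type u} [AddCommGroup X] (f : N →+ M →+ X)
    (hf : ∀ (r : R) n m, f (MulOpposite.op r • n) m = f n (r • m)) : bTensor R N M →+ X :=
  QuotientAddGroup.lift _ (TensorProduct.liftAddHom f (fun r n m => by simp)) (by
    rw [tensorRel, AddSubgroup.closure_le]
    rintro _ ⟨r, n, m, rfl⟩
    simp [hf])

theorem btLift_bt {X : Type u} [AddCommGroup X] (f : N →+ M →+ X)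
    (hf : ∀ (r : R) n m, f (MulOpposite.op r • n) m = f n (r • m)) (n : N) (m : M) :
    btLift f hf (bt R N M n m) = f n m := rfl

theorem tmapLeft_surj (g : N →ₗ[Rᵐᵒᵖ] N') (hg : Function.Surjective g) :
    Function.Surjective (tmapLeft R M g) := by
  intro x
  induction x using bt_induction with
  | h0 => exact ⟨0, map_zero _⟩
  | h1 n m =>
    obtain ⟨n, rfl⟩ := hg n
    exact ⟨bt R N M n m, rfl⟩
  | h2 x y hx hy =>
    obtain ⟨x, rfl⟩ := hx
    obtain ⟨y, rfl⟩ := hy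
    exact ⟨x + y, map_add _ _ _⟩

theorem tmap_comm (g : N →ₗ[Rᵐᵒᵖ] N') (f : M →ₗ[R] M') (x : bTensor R N M) :
    tmapRight R N' f (tmapLeft R M g x) = tmapLeft R M' g (tmapRight R N f x) :=
  bt_ext ((tmapRight R N' f).comp (tmapLeft R M g)) ((tmapLeft R M' g).comp (tmapRight R N f))
    (fun _ _ => rfl) x

end

/-- Exactness passes to retracts. -/
theorem aux_exact_retract {A B C A' B' C' : Type*} [AddCommGroup A] [AddCommGroup B]
    [AddCommGroup C] [AddCommGroup A'] [AddCommGroup B'] [AddCommGroup C']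
    (f : A →+ B) (g : B →+ C) (f' : A' →+ B') (g' : B' →+ C')
    (iA : A →+ A') (iB : B →+ B') (iC : C →+ C') (rA : A' →+ A) (rB : B' →+ B) (rC : C' →+ C)
    (hB : ∀ x, rB (iB x) = x) (hC : ∀ x, rC (iC x) = x)
    (hif : ∀ x, iB (f x) = f' (iA x)) (hig : ∀ x, iC (g x) = g' (iB x))
    (hrf : ∀ x, rB (f' x) = f (rA x))
    (h : Function.Exact f' g') : Function.Exact f g := by
  intro y
  constructor
  · intro hy
    obtain ⟨z, hz⟩ := (h (iB y)).1 (by rw [← hig, hy, map_zero])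
    exact ⟨rA z, by rw [← hrf, hz, hB]⟩
  · rintro ⟨x, rfl⟩
    rw [← hC (g (f x)), hig, hif, h.apply_apply_eq_zero, map_zero]

theorem aux_exact_finsupp {ι A B C : Type*} [AddCommGroup A] [AddCommGroup B]
    [AddCommGroup C] (f : A →+ B) (g : B →+ C) (h : Function.Exact f g) :
    Function.Exact (Finsupp.mapRange.addMonoidHom (ι := ι) f)
      (Finsupp.mapRange.addMonoidHom (ι := ι) g) := by
  classical
  intro y
  constructor
  · intro hy
    have hy' : ∀ i, ∃ a, f a = y i := fun i => (h _).1 (by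
      simpa using DFunLike.congr_fun hy i)
    choose a ha using hy'
    refine ⟨Finsupp.onFinset y.support (fun i => if y i = 0 then 0 else a i) (by
      intro i hi; simp only [Finsupp.mem_support_iff]; intro h0; simp [h0] at hi), ?_⟩
    ext i
    by_cases h0 : y i = 0
    · simp [h0]
    · simp [h0, ha]
  · rintro ⟨x, rfl⟩
    ext i
    simp [h.apply_apply_eq_zero]

section
variable {N : Type u} [AddCommGroup N] [Module Rᵐᵒᵖ N] {M : Type u} [AddCommGroup M] [Module R M]

/-- coordinates, right projective -/
noncomputable def coR (s : N →ₗ[Rᵐᵒᵖ] N →₀ Rᵐᵒᵖ) (M : Type u) [AddCommGroup M] [Module R M] :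
    bTensor R N M →+ (N →₀ M) :=
  btLift (AddMonoidHom.mk' (fun n => AddMonoidHom.mk'
      (fun m => (s n).mapRange (fun c => c.unop • m) (by simp))
      (fun m m' => by ext x; simp [smul_add]))
    (fun n n' => by ext m x; simp [add_smul]))
    (fun r n m => by
      ext x
      simp [mul_smul])

/-- reassembly -/
noncomputable def asR (R : Type u) [Ring R] (N : Type u) [AddCommGroup N] [Module Rᵐᵒᵖ N] (M : Type u) [AddCommGroup M]
    [Module R M] : (N →₀ M) →+ bTensor R N M :=
  Finsupp.liftAddHom (fun n => btHom R N M n)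

theorem asR_single (n : N) (m : M) : asR R N M (Finsupp.single n m) = bt R N M n m :=
  Finsupp.liftAddHom_apply_single _ n m

theorem asR_coR (s : N →ₗ[Rᵐᵒᵖ] N →₀ Rᵐᵒᵖ)
    (hs : ∀ n, Finsupp.linearCombination Rᵐᵒᵖ id (s n) = n) (x : bTensor R N M) :
    asR R N M (coR s M x) = x := by
  refine bt_ext ((asR R N M).comp (coR s M)) (AddMonoidHom.id _) (fun n m => ?_) x
  conv_rhs => rw [← hs n]
  change Finsupp.liftAddHom (fun n => btHom R N M n)
    ((s n).mapRange (fun c => c.unop • m) (by simp)) = btHom R N M _ m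
  rw [Finsupp.liftAddHom_apply, Finsupp.sum_mapRange_index (by simp),
    Finsupp.linearCombination_apply, Finsupp.sum, Finsupp.sum, map_sum, AddMonoidHom.finsetSum_apply]
  refine Finset.sum_congr rfl (fun c _ => ?_)
  exact (bt_smul (MulOpposite.unop (s n c)) c m).symm

/-- coordinates, left projective -/
noncomputable def coL (s : M →ₗ[R] M →₀ R) (N : Type u) [AddCommGroup N] [Module Rᵐᵒᵖ N] :
    bTensor R N M →+ (M →₀ N) :=
  btLift (AddMonoidHom.flip (AddMonoidHom.mk' (fun m => AddMonoidHom.mk'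
      (fun n => (s m).mapRange (fun c => MulOpposite.op c • n) (by simp))
      (fun m m' => by ext x; simp [smul_add]))
    (fun n n' => by ext m x; simp [add_smul])))
    (fun r n m => by
      ext x
      simp [mul_smul])

/-- reassembly -/
noncomputable def asL (R : Type u) [Ring R] (M : Type u) [AddCommGroup M]
    [Module R M] (N : Type u) [AddCommGroup N] [Module Rᵐᵒᵖ N] : (M →₀ N) →+ bTensor R N M :=
  Finsupp.liftAddHom (fun m => (btHom R N M).flip m)

theorem asL_single (n : N) (m : M) : asL R M N (Finsupp.single m n) = bt R N M n m :=
  Finsupp.liftAddHom_apply_single _ m n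

theorem asL_coL (s : M →ₗ[R] M →₀ R)
    (hs : ∀ n, Finsupp.linearCombination R id (s n) = n) (x : bTensor R N M) :
    asL R M N (coL s N x) = x := by
  refine bt_ext ((asL R M N).comp (coL s N)) (AddMonoidHom.id _) (fun n m => ?_) x
  conv_rhs => rw [← hs m]
  change Finsupp.liftAddHom (fun m => (btHom R N M).flip m)
    ((s m).mapRange (fun c => MulOpposite.op c • n) (by simp)) = btHom R N M n _
  rw [Finsupp.liftAddHom_apply, Finsupp.sum_mapRange_index (by simp),
    Finsupp.linearCombination_apply, Finsupp.sum, Finsupp.sum, map_sum]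
  refine Finset.sum_congr rfl (fun c _ => ?_)
  exact bt_smul (s m c) n c

end

theorem tmapRight_exact (N : Type u) [AddCommGroup N] [Module Rᵐᵒᵖ N]
    (hN : Module.Projective Rᵐᵒᵖ N)
    {A B C : Type u} [AddCommGroup A] [Module R A] [AddCommGroup B] [Module R B]
    [AddCommGroup C] [Module R C] (f : A →ₗ[R] B) (g : B →ₗ[R] C) (h : Function.Exact f g) :
    Function.Exact (tmapRight R N f) (tmapRight R N g) := by
  obtain ⟨s, hs⟩ := hN.out
  refine aux_exact_retract _ _ _ _ (coR s A) (coR s B) (coR s C) (asR R N A) (asR R N B) (asR R N C)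
    (asR_coR s hs) (asR_coR s hs) (fun x => ?_) (fun x => ?_) (fun x => ?_)
    (aux_exact_finsupp (ι := N) f.toAddMonoidHom g.toAddMonoidHom h)
  · refine bt_ext ((coR s B).comp (tmapRight R N f))
      ((Finsupp.mapRange.addMonoidHom f.toAddMonoidHom).comp (coR s A)) (fun n m => ?_) x
    ext i
    exact (map_smul f (s n i).unop m).symm
  · refine bt_ext ((coR s C).comp (tmapRight R N g))
      ((Finsupp.mapRange.addMonoidHom g.toAddMonoidHom).comp (coR s B)) (fun n m => ?_) x
    ext i
    exact (map_smul g (s n i).unop m).symm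
  · induction x using Finsupp.induction_linear with
    | zero => simp
    | add x y hx hy => simp only [map_add, hx, hy]
    | single n m => 
      rw [Finsupp.mapRange.addMonoidHom_apply, Finsupp.mapRange_single, asR_single, asR_single, tmapRight_bt]
      rfl

theorem tmapLeft_exact (M : Type u) [AddCommGroup M] [Module R M]
    (hM : Module.Projective R M)
    {A B C : Type u} [AddCommGroup A] [Module Rᵐᵒᵖ A] [AddCommGroup B] [Module Rᵐᵒᵖ B]
    [AddCommGroup C] [Module Rᵐᵒᵖ C] (f : A →ₗ[Rᵐᵒᵖ] B) (g : B →ₗ[Rᵐᵒᵖ] C)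
    (h : Function.Exact f g) :
    Function.Exact (tmapLeft R M f) (tmapLeft R M g) := by
  obtain ⟨s, hs⟩ := hM.out
  refine aux_exact_retract _ _ _ _ (coL s A) (coL s B) (coL s C) (asL R M A) (asL R M B) (asL R M C)
    (asL_coL s hs) (asL_coL s hs) (fun x => ?_) (fun x => ?_) (fun x => ?_)
    (aux_exact_finsupp (ι := M) f.toAddMonoidHom g.toAddMonoidHom h)
  · refine bt_ext ((coL s B).comp (tmapLeft R M f))
      ((Finsupp.mapRange.addMonoidHom f.toAddMonoidHom).comp (coL s A)) (fun n m => ?_) x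
    ext i
    exact (map_smul f (MulOpposite.op (s m i)) n).symm
  · refine bt_ext ((coL s C).comp (tmapLeft R M g))
      ((Finsupp.mapRange.addMonoidHom g.toAddMonoidHom).comp (coL s B)) (fun n m => ?_) x
    ext i
    exact (map_smul g (MulOpposite.op (s m i)) n).symm
  · induction x using Finsupp.induction_linear with
    | zero => simp
    | add x y hx hy => simp only [map_add, hx, hy]
    | single n m => 
      rw [Finsupp.mapRange.addMonoidHom_apply, Finsupp.mapRange_single, asL_single, asL_single, tmapLeft_bt]
      rfl

theorem modFlat_of_projective (M : Type u) [AddCommGroup M] [Module R M]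
    (hM : Module.Projective R M) : ModFlat R M := by
  intro N N' _ _ _ _ g hg
  have h := tmapLeft_exact M hM (0 : N →ₗ[Rᵐᵒᵖ] N) g (by
    intro x
    constructor
    · intro hx
      exact ⟨0, (hg (hx.trans (map_zero g).symm)).symm⟩
    · rintro ⟨y, rfl⟩
      simp)
  rw [injective_iff_map_eq_zero]
  intro x hx
  obtain ⟨y, rfl⟩ := (h x).1 hx
  exact bt_ext (tmapLeft R M (0 : N →ₗ[Rᵐᵒᵖ] N)) 0 (fun n m => by
    rw [tmapLeft_bt]
    exact DFunLike.congr_fun (map_zero (btHom R N M)) m) y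

end AuxTensor

/-- If `sup { l.Ggldim(R), r.Ggldim(R) }` is finite, then every Gorenstein projective
left `R`-module is Gorenstein flat. -/
theorem gorenstein_projective_is_gorenstein_flat (R : Type u) [Ring R]
    (h : max (GPgldim R) (GPgldim Rᵐᵒᵖ) ≠ ⊤)
    (M : Type u) [AddCommGroup M] [Module R M]
    (hM : GorensteinProjective R M) :
    GorensteinFlat R M := by
  obtain ⟨P, _, _, d, hP, hd, he, -⟩ := hM
  refine ⟨P, inferInstance, inferInstance, d, fun i => modFlat_of_projective _ (hP i), hd, he, ?_⟩
  intro E _ _ hE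
  have hfin : gpDim Rᵐᵒᵖ E ≠ ⊤ := by
    intro htop
    refine h (top_le_iff.1 (le_trans ?_ (le_max_right _ _)))
    rw [← htop]
    exact le_sSup ⟨E, inferInstance, inferInstance, rfl⟩
  obtain ⟨n, hn⟩ : ∃ n : ℕ,
      HasLeftResolutionLE Rᵐᵒᵖ (fun N _ _ => GorensteinProjective Rᵐᵒᵖ N) E n := by
    by_contra hcon
    push Not at hcon
    apply hfin
    rw [gpDim]
    have : {n : ℕ | HasLeftResolutionLE Rᵐᵒᵖ (fun N _ _ => GorensteinProjective Rᵐᵒᵖ N) E n} = ∅ :=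
      Set.eq_empty_iff_forall_notMem.2 hcon
    rw [this, Set.image_empty, sInf_empty]
  obtain ⟨Q, G, _, _, _, _, a, b, hab, hQ, -⟩ := aux_main
    (fun N _ _ => ∀ i, Function.Exact (tmapRight R N (d i)) (tmapRight R N (d (i + 1))))
    (fun N _ _ hN i => tmapRight_exact N hN _ _ (hd i))
    (by
      intro A B C _ _ _ _ _ _ f g ⟨hf, hfg, hg⟩ hA hB i
      have F := fun i => modFlat_of_projective _ (hP i) A B _ _ _ _ f hf
      have X := fun i => tmapLeft_exact _ (hP i) f g hfg
      have Y := fun i => tmapLeft_surj (M := P i) g hg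
      intro c
      constructor
      · intro hc
        obtain ⟨y, rfl⟩ := Y _ c
        rw [tmap_comm] at hc
        obtain ⟨z, hz⟩ := (X _ _).1 hc
        have hz0 : tmapRight R A (d (i + 1 + 1)) z = 0 := by
          apply F
          rw [← tmap_comm, hz, (hB _).apply_apply_eq_zero, map_zero]
        obtain ⟨z', rfl⟩ := (hA _ _).1 hz0
        obtain ⟨y', hy'⟩ := (hB i (y - tmapLeft R _ f z')).1 (by
          rw [map_sub, tmap_comm, hz, sub_self])
        refine ⟨tmapLeft R _ g y', ?_⟩
        rw [tmap_comm, hy', map_sub, (X _).apply_apply_eq_zero, sub_zero]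
      · rintro ⟨c, rfl⟩
        obtain ⟨y, rfl⟩ := Y _ c
        rw [tmap_comm, tmap_comm, (hB _).apply_apply_eq_zero, map_zero])
    n E hn
  obtain ⟨r, hr⟩ := hE.out a hab.1 LinearMap.id
  have hra : ∀ (i) (x : bTensor R E (P i)), tmapLeft R (P i) r (tmapLeft R (P i) a x) = x := by
    intro i x
    refine bt_ext ((tmapLeft R (P i) r).comp (tmapLeft R (P i) a)) (AddMonoidHom.id _)
      (fun n m => ?_) x
    change bt R E (P i) (r (a n)) m = bt R E (P i) n m
    rw [hr]; rfl
  intro i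
  exact aux_exact_retract _ _ _ _ (tmapLeft R _ a) (tmapLeft R _ a) (tmapLeft R _ a)
    (tmapLeft R _ r) (tmapLeft R _ r) (tmapLeft R _ r) (hra _) (hra _)
    (fun x => (tmap_comm a (d i) x).symm) (fun x => (tmap_comm a (d (i + 1)) x).symm)
    (fun x => (tmap_comm r (d i) x).symm) (hQ i)
end

section
/- The left finitistic projective dimension l.FPD(R) is at most the left Gorenstein global dimension l.Ggldim(R), which is at most the left global dimension l.gldim(R). -/
/-! Definitions for Gorenstein homological algebra over an arbitrary
associative ring `R` (left modules; right modules are `Rᵐᵒᵖ`-modules). -/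

universe u

section Helpers

open CategoryTheory Abelian

variable {R : Type u} [Ring R]

/-- `Ext^i(M, Q) = 0`. -/
def ExtVan (M Q : Type u) [AddCommGroup M] [Module R M] [AddCommGroup Q] [Module R Q]
    (i : ℕ) : Prop :=
  ∀ x : Ext.{u} (ModuleCat.of R M) (ModuleCat.of R Q) i, x = 0

variable {P M N Q : Type u} [AddCommGroup P] [Module R P] [AddCommGroup M] [Module R M]
  [AddCommGroup Q] [Module R Q] [AddCommGroup N] [Module R N]

theorem extVan_of_projective [Module.Projective R P] (i : ℕ) :
    ExtVan (R := R) P Q (i + 1) := by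
  intro x
  have : Projective (ModuleCat.of R P) := (IsProjective.iff_projective _).1 inferInstance
  exact x.eq_zero_of_projective

theorem ExtVan.congr (e : M ≃ₗ[R] N) {i : ℕ} (h : ExtVan (R := R) N Q i) :
    ExtVan (R := R) M Q i := by
  intro x
  rw [← x.mk₀_id_comp, ← e.toModuleIso.hom_inv_id, ← Ext.mk₀_comp_mk₀_assoc]
  have h2 := h ((Ext.mk₀ e.toModuleIso.inv).comp x (zero_add i))
  rw [h2, Ext.comp_zero]

theorem extVan_up {f : P →ₗ[R] M} (hf : Function.Surjective f) {i : ℕ}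
    (hK : ExtVan (R := R) (LinearMap.ker f) Q i) (hP : ExtVan (R := R) P Q (i + 1)) :
    ExtVan (R := R) M Q (i + 1) := by
  intro x
  obtain ⟨y, rfl⟩ := Ext.contravariant_sequence_exact₃ (LinearMap.shortExact_shortComplexKer hf)
    (ModuleCat.of R Q) x (hP _) (add_comm 1 i)
  rw [show y = 0 from hK y, Ext.comp_zero]

theorem extVan_down {f : P →ₗ[R] M} (hf : Function.Surjective f) {i : ℕ}
    (hP : ExtVan (R := R) P Q i) (hM : ExtVan (R := R) M Q (i + 1)) :
    ExtVan (R := R) (LinearMap.ker f) Q i := by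
  intro x
  obtain ⟨y, rfl⟩ := Ext.contravariant_sequence_exact₁ (LinearMap.shortExact_shortComplexKer hf)
    (ModuleCat.of R Q) x (add_comm 1 i) (hM _)
  rw [show y = 0 from hP y, Ext.comp_zero]

theorem extVan_one {f : P →ₗ[R] M} (hf : Function.Surjective f)
    (hext : ∀ h : LinearMap.ker f →ₗ[R] Q, ∃ g : P →ₗ[R] Q, g.comp (LinearMap.ker f).subtype = h)
    (hP : ExtVan (R := R) P Q 1) : ExtVan (R := R) M Q 1 := by
  intro x
  have hS := LinearMap.shortExact_shortComplexKer hf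
  obtain ⟨y, rfl⟩ := Ext.contravariant_sequence_exact₃ hS
    (ModuleCat.of R Q) x (hP _) (add_zero 1)
  obtain ⟨h, rfl⟩ := Ext.homEquiv₀.symm.surjective y
  obtain ⟨g, hg⟩ := hext h.hom
  have : h = (LinearMap.shortComplexKer f).f ≫ ModuleCat.ofHom g := by
    ext a
    exact (LinearMap.congr_fun hg a).symm
  rw [this, Ext.homEquiv₀_symm_apply, ← Ext.mk₀_comp_mk₀]
  exact hS.extClass_comp_assoc _

/-- If `Ext^1(M, ker f) = 0` then `f` splits. -/
theorem exists_extend {f : P →ₗ[R] M} (hf : Function.Surjective f)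
    (h : ExtVan (R := R) M (LinearMap.ker f) 1) :
    ∃ g : M →ₗ[R] P, f.comp g = LinearMap.id := by
  have hS := LinearMap.shortExact_shortComplexKer hf
  obtain ⟨y, hy⟩ := Ext.covariant_sequence_exact₃ (ModuleCat.of R M) hS
    (Ext.mk₀ (𝟙 (ModuleCat.of R M))) (zero_add 1) (h _)
  obtain ⟨g, rfl⟩ := Ext.homEquiv₀.symm.surjective y
  have h2 : g ≫ (LinearMap.shortComplexKer f).g = 𝟙 (ModuleCat.of R M) :=
    Ext.homEquiv₀.symm.injective (by simpa using hy)
  refine ⟨g.hom, ?_⟩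
  ext a
  exact congrArg (fun k => k.hom a) h2

theorem projective_of_ext {f : P →ₗ[R] M} (hf : Function.Surjective f) [Module.Projective R P]
    (h : ExtVan (R := R) M (LinearMap.ker f) 1) : Module.Projective R M := by
  obtain ⟨g, hg⟩ := exists_extend hf h
  exact Module.Projective.of_split g f hg

theorem gorenstein_of_projective (hM : Module.Projective R M) : GorensteinProjective R M := by
  let d : M × M →ₗ[R] M × M := (LinearMap.inl R M M).comp (LinearMap.snd R M M)
  let s : M × M →ₗ[R] M × M := (LinearMap.inr R M M).comp (LinearMap.fst R M M)
  refine ⟨fun _ => M × M, fun _ => inferInstance, fun _ => inferInstance, fun _ => d,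
    fun _ => inferInstance, ?_, ⟨?_⟩, ?_⟩
  · rintro _ ⟨a, b⟩
    constructor
    · intro h
      have : b = 0 := congrArg Prod.fst h
      exact ⟨(0, a), by simp [d, this]⟩
    · rintro ⟨⟨x, y⟩, h⟩
      rw [← h]; simp [d]
  · exact
      { toFun := fun m => ⟨(m, 0), by simp [d]⟩
        invFun := fun x => x.1.1
        map_add' := fun x y => by ext <;> simp
        map_smul' := fun r x => by ext <;> simp
        left_inv := fun x => rfl
        right_inv := fun ⟨⟨x, y⟩, h⟩ => by
          have : y = 0 := congrArg Prod.fst (LinearMap.mem_ker.1 h)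
          subst this; rfl }
  · intro Q _ _ _ _ g
    constructor
    · intro h
      refine ⟨g.comp s, ?_⟩
      refine LinearMap.ext fun ⟨x, y⟩ => ?_
      have h1 : g (x, 0) = 0 := by simpa [d] using LinearMap.congr_fun h (0, x)
      have h2 : g (x, y) = g (x, 0) + g (0, y) := by rw [← map_add]; simp
      rw [h2, h1]; simp [d, s]
    · rintro ⟨k, rfl⟩
      refine LinearMap.ext fun ⟨x, y⟩ => ?_
      have h0 : k (0, 0) = 0 := map_zero k
      simp [d, h0]

theorem ker_extVan (P : ℤ → Type u) [∀ i, AddCommGroup (P i)] [∀ i, Module R (P i)]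
    (d : ∀ i, P i →ₗ[R] P (i + 1)) (hP : ∀ i, Module.Projective R (P i))
    (hd : ∀ i, Function.Exact (d i) (d (i + 1)))
    (hQ : ∀ i, Function.Exact (fun g : P (i + 1 + 1) →ₗ[R] Q => g.comp (d (i + 1)))
          (fun g : P (i + 1) →ₗ[R] Q => g.comp (d i))) (k : ℕ) :
    ∀ j, ExtVan (R := R) (LinearMap.ker (d j)) Q (k + 1) := by
  have hmem : ∀ i x, d i x ∈ LinearMap.ker (d (i + 1)) := fun i x =>
    (hd i (d i x)).2 ⟨x, rfl⟩
  have hsurj : ∀ i, Function.Surjective ((d i).codRestrict _ (hmem i)) := by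
    rintro i ⟨y, hy⟩
    obtain ⟨x, rfl⟩ := (hd i y).1 hy
    exact ⟨x, rfl⟩
  have hker : ∀ i, LinearMap.ker ((d i).codRestrict _ (hmem i)) = LinearMap.ker (d i) :=
    fun i => LinearMap.ker_codRestrict _ _ _
  induction k with
  | zero =>
    intro j
    obtain ⟨j, rfl⟩ : ∃ i, j = i + 1 := ⟨j - 1, by omega⟩
    obtain ⟨j, rfl⟩ : ∃ i, j = i + 1 := ⟨j - 1, by omega⟩
    obtain ⟨j, rfl⟩ : ∃ i, j = i + 1 := ⟨j - 1, by omega⟩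
    refine extVan_one (hsurj _) ?_ (extVan_of_projective 0)
    rw [hker]
    intro h
    obtain ⟨g, hg⟩ := (hQ j (h.comp ((d (j + 1)).codRestrict _ (hmem (j + 1))))).1 (by
      ext x
      have : (d (j + 1)).codRestrict _ (hmem (j + 1)) (d j x) = 0 :=
        Subtype.ext ((hd j (d j x)).2 ⟨x, rfl⟩)
      simp [this])
    refine ⟨g, ?_⟩
    ext y
    obtain ⟨x, rfl⟩ := hsurj _ y
    exact LinearMap.congr_fun hg x
  | succ k ih =>
    intro j
    obtain ⟨j, rfl⟩ : ∃ i, j = i + 1 := ⟨j - 1, by omega⟩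
    refine extVan_up (hsurj _) ?_ (extVan_of_projective _)
    rw [hker]
    exact ih j

theorem GorensteinProjective.extVan (hM : GorensteinProjective R M) (hQ : Module.Projective R Q)
    (k : ℕ) : ExtVan (R := R) M Q (k + 1) := by
  obtain ⟨P, _, _, d, hP, hd, ⟨e⟩, h⟩ := hM
  exact (ker_extVan P d hP hd (h Q _ _ hQ) k 0).congr e

/-- Peel off the first term of a resolution. -/
theorem HasLeftResolutionLE.succ {𝒢 : ∀ (N : Type u) [AddCommGroup N] [Module R N], Prop} {n : ℕ}
    (h : HasLeftResolutionLE R 𝒢 M (n + 1)) :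
    ∃ (G : Type u) (_ : AddCommGroup G) (_ : Module R G) (f : G →ₗ[R] M), 𝒢 G ∧
      Function.Surjective f ∧ HasLeftResolutionLE R 𝒢 (LinearMap.ker f) n := by
  obtain ⟨G, _, _, d, π, h1, h2, h3, h4, h5⟩ := h
  have hmem : ∀ x, d 0 x ∈ LinearMap.ker π := fun x => (h4 _).2 ⟨x, rfl⟩
  refine ⟨G 0, inferInstance, inferInstance, π, h1 0, h3, fun i => G (i + 1),
    fun _ => inferInstance, fun _ => inferInstance, fun i => d (i + 1),
    (d 0).codRestrict _ hmem, fun i => h1 _, fun i hi => h2 _ (by omega), ?_, ?_,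
    fun i => h5 (i + 1)⟩
  · rintro ⟨y, hy⟩
    obtain ⟨x, rfl⟩ := (h4 y).1 hy
    exact ⟨x, rfl⟩
  · intro x
    rw [← h5 0 x]
    exact Subtype.ext_iff

theorem HasLeftResolutionLE.zero {𝒢 : ∀ (N : Type u) [AddCommGroup N] [Module R N], Prop}
    (h : HasLeftResolutionLE R 𝒢 M 0) :
    ∃ (G : Type u) (_ : AddCommGroup G) (_ : Module R G), 𝒢 G ∧ Nonempty (M ≃ₗ[R] G) := by
  obtain ⟨G, _, _, d, π, h1, h2, h3, h4, h5⟩ := h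
  refine ⟨G 0, inferInstance, inferInstance, h1 0,
    ⟨(LinearEquiv.ofBijective π ⟨?_, h3⟩).symm⟩⟩
  rw [injective_iff_map_eq_zero]
  intro x hx
  obtain ⟨y, rfl⟩ := (h4 x).1 hx
  have := h2 1 one_pos
  rw [Subsingleton.elim y 0, map_zero]

theorem HasLeftResolutionLE.mono {𝒢 : ∀ (N : Type u) [AddCommGroup N] [Module R N], Prop}
    {m n : ℕ} (hmn : m ≤ n) (h : HasLeftResolutionLE R 𝒢 M m) : HasLeftResolutionLE R 𝒢 M n := by
  obtain ⟨G, _, _, d, π, h1, h2, h3⟩ := h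
  exact ⟨G, _, _, d, π, h1, fun i hi => h2 i (by omega), h3⟩

/-- The modules in the spliced resolution. -/
def spliceObj (P : Type u) [AddCommGroup P] [Module R P] (G : ℕ → ModuleCat.{u} R) :
    ℕ → ModuleCat.{u} R
  | 0 => ModuleCat.of R P
  | i + 1 => G i

theorem HasLeftResolutionLE.splice {n : ℕ} [hP : Module.Projective R P] {f : P →ₗ[R] M}
    (hf : Function.Surjective f)
    (h : HasLeftResolutionLE R (fun N _ _ => Module.Projective R N) (LinearMap.ker f) n) :
    HasLeftResolutionLE R (fun N _ _ => Module.Projective R N) M (n + 1) := by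
  obtain ⟨G, _, _, d, π, h1, h2, h3, h4, h5⟩ := h
  let G' : ℕ → ModuleCat.{u} R := spliceObj P fun i => ModuleCat.of R (G i)
  let d' : ∀ i, G' (i + 1) →ₗ[R] G' i := fun i => match i with
    | 0 => ((LinearMap.ker f).subtype.comp π : G 0 →ₗ[R] P)
    | i + 1 => d i
  refine ⟨fun i => G' i, fun _ => inferInstance, fun _ => inferInstance, d', f, ?_, ?_, hf, ?_, ?_⟩
  · rintro (_ | i)
    · exact hP
    · exact h1 i
  · rintro (_ | i) hi
    · omega
    · exact h2 i (by omega)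
  · intro y
    constructor
    · intro hy
      obtain ⟨x, hx⟩ := h3 ⟨y, hy⟩
      exact ⟨x, congrArg Subtype.val hx⟩
    · rintro ⟨x, rfl⟩
      exact (π x).2
  · rintro (_ | i)
    · intro x
      refine Iff.trans ?_ (h4 x)
      exact (Subtype.ext_iff (a1 := π x) (a2 := 0)).symm
    · exact h5 i

theorem HasLeftResolutionLE.of_projective (hM : Module.Projective R M) :
    HasLeftResolutionLE R (fun N _ _ => Module.Projective R N) M 0 := by
  let G' : ℕ → ModuleCat.{u} R := spliceObj M fun i => ModuleCat.of R PUnit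
  refine ⟨fun i => G' i, fun _ => inferInstance, fun _ => inferInstance, fun _ => 0,
    LinearMap.id, ?_, ?_, fun x => ⟨x, rfl⟩, ?_, ?_⟩
  · rintro (_ | i)
    · exact hM
    · exact (inferInstance : Module.Projective R PUnit.{u+1})
  · rintro (_ | i) hi
    · omega
    · exact (inferInstance : Subsingleton PUnit.{u+1})
  · intro y
    constructor
    · intro hy
      exact ⟨0, hy.symm⟩
    · rintro ⟨x, rfl⟩
      rfl
  · intro i y
    exact ⟨fun _ => ⟨0, (inferInstance : Subsingleton PUnit.{u+1}).elim _ _⟩, fun _ => rfl⟩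

theorem gp_extVan (hQ : Module.Projective R Q) {m : ℕ} :
    ∀ {M : Type u} [AddCommGroup M] [Module R M],
    HasLeftResolutionLE R (fun N _ _ => GorensteinProjective R N) M m →
    ∀ i, m < i → ExtVan (R := R) M Q i := by
  induction m with
  | zero =>
    intro M _ _ h i hi
    obtain ⟨i, rfl⟩ : ∃ k, i = k + 1 := ⟨i - 1, by omega⟩
    obtain ⟨G, _, _, hG, ⟨e⟩⟩ := h.zero
    exact (GorensteinProjective.extVan hG hQ i).congr e
  | succ m ih =>
    intro M _ _ h i hi
    obtain ⟨i, rfl⟩ : ∃ k, i = k + 1 := ⟨i - 1, by omega⟩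
    obtain ⟨G, _, _, f, hG, hf, hK⟩ := h.succ
    exact extVan_up hf (ih hK i (by omega)) (GorensteinProjective.extVan hG hQ i)

/-- All `Ext^i(M, Q)`, `i > m`, `Q` projective, vanish. -/
def VanAbove (R : Type u) [Ring R] (M : Type u) [AddCommGroup M] [Module R M] (m : ℕ) : Prop :=
  ∀ (Q : Type u) [AddCommGroup Q] [Module R Q], Module.Projective R Q →
    ∀ i, m < i → ExtVan (R := R) M Q i

theorem projective_of_vanAbove {n : ℕ} : ∀ {M : Type u} [AddCommGroup M] [Module R M],
    HasLeftResolutionLE R (fun N _ _ => Module.Projective R N) M n → VanAbove R M 0 →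
    Module.Projective R M := by
  induction n with
  | zero =>
    intro M _ _ h _
    obtain ⟨G, _, _, hG, ⟨e⟩⟩ := h.zero
    exact Module.Projective.of_equiv e.symm
  | succ n ih =>
    intro M _ _ h hv
    obtain ⟨G, _, _, f, hG, hf, hK⟩ := h.succ
    have : Module.Projective R (LinearMap.ker f) := ih hK (by
      intro Q _ _ hQ i hi
      obtain ⟨i, rfl⟩ : ∃ k, i = k + 1 := ⟨i - 1, by omega⟩
      exact extVan_down hf (extVan_of_projective i) (hv Q hQ _ (by omega)))
    exact projective_of_ext hf (hv _ this 1 one_pos)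

theorem resolution_of_vanAbove {m : ℕ} : ∀ {n : ℕ} {M : Type u} [AddCommGroup M] [Module R M],
    HasLeftResolutionLE R (fun N _ _ => Module.Projective R N) M n → VanAbove R M m →
    HasLeftResolutionLE R (fun N _ _ => Module.Projective R N) M m := by
  induction m with
  | zero =>
    intro n M _ _ h hv
    exact .of_projective (projective_of_vanAbove h hv)
  | succ m ih =>
    intro n M _ _ h hv
    obtain ⟨G, _, _, f, hG, hf, hK⟩ := (h.mono n.le_succ).succ
    refine .splice hf (ih hK ?_)
    intro Q _ _ hQ i hi
    obtain ⟨i, rfl⟩ : ∃ k, i = k + 1 := ⟨i - 1, by omega⟩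
    exact extVan_down hf (extVan_of_projective i) (hv Q hQ _ (by omega))

theorem gpDim_le_pDim : gpDim R M ≤ pDim R M := by
  refine sInf_le_sInf (Set.image_mono ?_)
  rintro n ⟨G, _, _, d, π, h1, h2⟩
  exact ⟨G, _, _, d, π, fun i => gorenstein_of_projective (h1 i), h2⟩

theorem pDim_le_gpDim (h : pDim R M ≠ ⊤) : pDim R M ≤ gpDim R M := by
  obtain ⟨n, hn⟩ : {n : ℕ |
      HasLeftResolutionLE R (fun N _ _ => Module.Projective R N) M n}.Nonempty := by
    by_contra hne
    rw [Set.not_nonempty_iff_eq_empty] at hne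
    exact h (by rw [pDim, hne, Set.image_empty, sInf_empty])
  refine le_sInf ?_
  rintro _ ⟨m, hm, rfl⟩
  exact sInf_le ⟨m, resolution_of_vanAbove hn fun Q _ _ hQ i hi => gp_extVan hQ hm i hi, rfl⟩

end Helpers

/-- `l.FPD(R) ≤ l.Ggldim(R) ≤ l.gldim(R)`. -/
theorem FPD_le_GPgldim_le_gldim (R : Type u) [Ring R] :
    FPD R ≤ GPgldim R ∧ GPgldim R ≤ gldim R := by

  constructor
  · refine sSup_le ?_
    rintro _ ⟨M, _, _, h, rfl⟩
    exact (pDim_le_gpDim h).trans (le_sSup ⟨M, _, _, rfl⟩)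
  · refine sSup_le ?_
    rintro _ ⟨M, _, _, rfl⟩
    exact gpDim_le_pDim.trans (le_sSup ⟨M, _, _, rfl⟩)
end
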